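/- arXiv:1410.4326 — 3 statements merged into one kernel-verified Lean document; each statement's English description precedes it below -/
import Mathlib

section
/- A finite group G is nilpotent if and only if the function m ↦ a_m(G) is multiplicative, i.e., a_{mn}(G) = a_m(G) · a_n(G) for all coprime natural numbers m and n. (Equivalently, ζ_G(s) admits an Euler product ζ_G(s) = Π_{p ∣ |G|} f_p(p^{-s}) with polynomials f_p satisfying f_p(0) = 1, and such a factorization is unique, the coefficient of X^k in f_p(X) necessarily being a_{p^k}(G).) -/
/-- `subCount G m` is the number of subgroups of `G` of order `m`,
i.e. the coefficient `a_m(G)` of the zeta function `ζ_G(s) = Σ_m a_m(G) m^{-s}`. -/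
noncomputable def subCount (G : Type*) [Group G] (m : ℕ) : ℕ :=
  Nat.card {H : Subgroup G // Nat.card H = m}

namespace Group

/-- In a finite nilpotent group, elements of coprime orders commute. -/
theorem IsNilpotent.commute_of_coprime_orderOf {G : Type*} [Group G] [Finite G]
    (hG : Group.IsNilpotent G) {x y : G} (h : (orderOf x).Coprime (orderOf y)) :
    Commute x y := by
  obtain ⟨e⟩ := ((Group.isNilpotent_of_finite_tfae (G := G)).out 0 4).mp hG
  rw [← MulEquiv.orderOf_eq e.symm x, ← MulEquiv.orderOf_eq e.symm y] at h
  suffices hc : Commute (e.symm x) (e.symm y) by simpa using hc.map e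
  generalize e.symm x = u at h
  generalize e.symm y = v at h
  refine Pi.commute_iff.mpr fun p ↦ Pi.commute_iff.mpr fun P ↦ ?_
  have : Fact (p : ℕ).Prime := ⟨Nat.prime_of_mem_primeFactors p.2⟩
  have hu : orderOf (u p P) ∣ orderOf u :=
    orderOf_dvd_of_pow_eq_one (by rw [← Pi.pow_apply, ← Pi.pow_apply, pow_orderOf_eq_one]; rfl)
  have hv : orderOf (v p P) ∣ orderOf v :=
    orderOf_dvd_of_pow_eq_one (by rw [← Pi.pow_apply, ← Pi.pow_apply, pow_orderOf_eq_one]; rfl)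
  have hcop : (orderOf (u p P)).Coprime (orderOf (v p P)) :=
    Nat.Coprime.of_dvd hu hv h
  obtain ⟨a, ha⟩ := IsPGroup.iff_orderOf.mp P.isPGroup' (u p P)
  obtain ⟨b, hb⟩ := IsPGroup.iff_orderOf.mp P.isPGroup' (v p P)
  rw [ha, hb] at hcop
  rcases Nat.eq_zero_or_pos a with rfl | ha0
  · rw [pow_zero, orderOf_eq_one_iff] at ha
    rw [ha]
    exact Commute.one_left _
  rcases Nat.eq_zero_or_pos b with rfl | hb0
  · rw [pow_zero, orderOf_eq_one_iff] at hb
    rw [hb]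
    exact Commute.one_right _
  rw [Nat.coprime_pow_left_iff ha0, Nat.coprime_pow_right_iff hb0, Nat.coprime_self] at hcop
  exact absurd hcop this.out.ne_one

theorem IsNilpotent.commute_of_mem_of_coprime_card {G : Type*} [Group G] [Finite G]
    (hG : Group.IsNilpotent G) {A B : Subgroup G} (h : (Nat.card A).Coprime (Nat.card B))
    {x y : G} (hx : x ∈ A) (hy : y ∈ B) : Commute x y :=
  hG.commute_of_coprime_orderOf <|
    Nat.Coprime.of_dvd (Subgroup.orderOf_dvd_natCard A hx) (Subgroup.orderOf_dvd_natCard B hy) h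

end Group

namespace Subgroup

variable {G : Type*} [Group G] {A B : Subgroup G}

theorem mem_sup_of_commute (hc : ∀ x ∈ A, ∀ y ∈ B, Commute x y) {z : G} :
    z ∈ A ⊔ B ↔ ∃ x ∈ A, ∃ y ∈ B, x * y = z := by
  have hr := MonoidHom.noncommCoprod_range A.subtype B.subtype fun x y ↦ hc x x.2 y y.2
  rw [A.range_subtype, B.range_subtype] at hr
  rw [← hr]
  constructor
  · rintro ⟨⟨x, y⟩, rfl⟩
    exact ⟨x, x.2, y, y.2, rfl⟩
  · rintro ⟨x, hx, y, hy, rfl⟩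
    exact ⟨(⟨x, hx⟩, ⟨y, hy⟩), rfl⟩

theorem card_sup_of_commute_of_coprime (hc : ∀ x ∈ A, ∀ y ∈ B, Commute x y)
    (h : (Nat.card A).Coprime (Nat.card B)) :
    Nat.card (A ⊔ B : Subgroup G) = Nat.card A * Nat.card B := by
  have hr := MonoidHom.noncommCoprod_range A.subtype B.subtype fun x y ↦ hc x x.2 y y.2
  rw [A.range_subtype, B.range_subtype] at hr
  have hinj := (MonoidHom.noncommCoprod_injective A.subtype B.subtype
    fun x y ↦ hc x x.2 y y.2).mpr ⟨A.subtype_injective, B.subtype_injective, by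
      rw [A.range_subtype, B.range_subtype]
      exact disjoint_of_coprime_natCard h⟩
  rw [← hr, ← Nat.card_prod]
  exact (Nat.card_congr (MonoidHom.ofInjective hinj).toEquiv).symm

theorem pow_natCard_of_mem {x : G} (hx : x ∈ A) : x ^ Nat.card A = 1 :=
  orderOf_dvd_iff_pow_eq_one.mp (orderOf_dvd_natCard A hx)

/-- If `A` and `B` commute and have coprime orders, then `A` is recovered from `A ⊔ B` as the set
of elements killed by the order of `A`. -/
theorem mem_left_iff_of_commute_of_coprime (hc : ∀ x ∈ A, ∀ y ∈ B, Commute x y)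
    (h : (Nat.card A).Coprime (Nat.card B)) {z : G} :
    z ∈ A ↔ z ∈ A ⊔ B ∧ z ^ Nat.card A = 1 := by
  refine ⟨fun hz ↦ ⟨le_sup_left (a := A) hz, pow_natCard_of_mem hz⟩, fun ⟨hz, hp⟩ ↦ ?_⟩
  obtain ⟨x, hx, y, hy, rfl⟩ := (mem_sup_of_commute hc).mp hz
  rw [(hc x hx y hy).mul_pow, pow_natCard_of_mem hx, one_mul] at hp
  have hy1 : y = 1 := by
    rw [← orderOf_eq_one_iff]
    exact Nat.eq_one_of_dvd_coprimes h (orderOf_dvd_of_pow_eq_one hp) (orderOf_dvd_natCard B hy)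
  rwa [hy1, mul_one]

end Subgroup

/-- A finite nilpotent group satisfies the converse of Lagrange's theorem. -/
theorem Group.IsNilpotent.exists_subgroup_card_eq {G : Type*} [Group G] [Finite G]
    (hG : Group.IsNilpotent G) {m : ℕ} (hm : m ∣ Nat.card G) :
    ∃ K : Subgroup G, Nat.card K = m := by
  induction m using Nat.recOnPrimeCoprime with
  | zero => exact absurd (zero_dvd_iff.mp hm) Nat.card_pos.ne'
  | prime_pow p n hp =>
    have : Fact p.Prime := ⟨hp⟩
    exact Sylow.exists_subgroup_card_pow_prime p hm
  | coprime a b _ _ hab iha ihb =>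
    obtain ⟨A, rfl⟩ := iha (dvd_of_mul_right_dvd hm)
    obtain ⟨B, rfl⟩ := ihb (dvd_of_mul_left_dvd hm)
    exact ⟨A ⊔ B, Subgroup.card_sup_of_commute_of_coprime
      (fun _ hx _ hy ↦ hG.commute_of_mem_of_coprime_card hab hx hy) hab⟩

theorem Group.IsNilpotent.exists_subgroup_le_card_eq {G : Type*} [Group G] [Finite G]
    (hG : Group.IsNilpotent G) (H : Subgroup G) {m : ℕ} (hm : m ∣ Nat.card H) :
    ∃ K ≤ H, Nat.card K = m := by
  have hH : Group.IsNilpotent H := inferInstance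
  obtain ⟨K, rfl⟩ := hH.exists_subgroup_card_eq hm
  exact ⟨K.map H.subtype, Subgroup.map_subtype_le K,
    Subgroup.card_map_of_injective H.subtype_injective⟩

theorem Group.IsNilpotent.subCount_mul {G : Type*} [Group G] [Finite G]
    (hG : Group.IsNilpotent G) {m n : ℕ} (hmn : m.Coprime n) :
    subCount G (m * n) = subCount G m * subCount G n := by
  have hcard {A B : Subgroup G} (hA : Nat.card A = m) (hB : Nat.card B = n) :
      Nat.card (A ⊔ B : Subgroup G) = m * n := by
    subst hA hB
    exact Subgroup.card_sup_of_commute_of_coprime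
      (fun _ hx _ hy ↦ hG.commute_of_mem_of_coprime_card hmn hx hy) hmn
  have hleft {A B : Subgroup G} {k l : ℕ} (hkl : k.Coprime l) (hA : Nat.card A = k)
      (hB : Nat.card B = l) (z : G) : z ∈ A ↔ z ∈ A ⊔ B ∧ z ^ k = 1 := by
    subst hA hB
    exact Subgroup.mem_left_iff_of_commute_of_coprime
      (fun _ hx _ hy ↦ hG.commute_of_mem_of_coprime_card hkl hx hy) hkl
  unfold subCount
  rw [← Nat.card_prod]
  symm
  refine Nat.card_congr (Equiv.ofBijective
    (fun q ↦ ⟨q.1.1 ⊔ q.2.1, hcard q.1.2 q.2.2⟩) ⟨?_, ?_⟩)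
  · rintro ⟨⟨A, hA⟩, ⟨B, hB⟩⟩ ⟨⟨A', hA'⟩, ⟨B', hB'⟩⟩ heq
    have hsup : A ⊔ B = A' ⊔ B' := congrArg Subtype.val heq
    have hAA : A = A' := by
      ext z
      rw [hleft hmn hA hB, hleft hmn hA' hB', hsup]
    have hBB : B = B' := by
      ext z
      rw [hleft hmn.symm hB hA, hleft hmn.symm hB' hA', sup_comm B A, sup_comm B' A', hsup]
    subst hAA hBB
    rfl
  · rintro ⟨H, hH⟩
    obtain ⟨A, hAH, hA⟩ := hG.exists_subgroup_le_card_eq H (hH ▸ dvd_mul_right m n)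
    obtain ⟨B, hBH, hB⟩ := hG.exists_subgroup_le_card_eq H (hH ▸ dvd_mul_left n m)
    exact ⟨⟨⟨A, hA⟩, ⟨B, hB⟩⟩, Subtype.ext <|
      Subgroup.eq_of_le_of_card_ge (sup_le hAH hBH) (hH.trans (hcard hA hB).symm).le⟩

theorem subCount_natCard (G : Type*) [Group G] [Finite G] : subCount G (Nat.card G) = 1 := by
  refine Nat.card_eq_one_iff_exists.mpr ⟨⟨⊤, Subgroup.card_top⟩, fun H ↦ Subtype.ext ?_⟩
  exact Subgroup.eq_top_of_card_eq _ H.2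

theorem Subgroup.normal_of_subCount_eq_one {G : Type*} [Group G] (H : Subgroup G)
    (h : subCount G (Nat.card H) = 1) : H.Normal := by
  have := (Nat.card_eq_one_iff_unique.mp h).1
  refine Subgroup.normal_iff_map_conj_eq.mpr fun g ↦ ?_
  exact congrArg Subtype.val (Subsingleton.elim
    (⟨H.map (MulAut.conj g), Subgroup.card_map_of_injective (MulAut.conj g).injective⟩ :
      {K : Subgroup G // Nat.card K = Nat.card H}) ⟨H, rfl⟩)

/-- A finite group `G` is nilpotent iff `m ↦ a_m(G)` is multiplicative, i.e. the
zeta function of `G` admits an Euler product `ζ_G(s) = Π_{p ∣ |G|} f_p(p^{-s})`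
with `f_p(0) = 1` (in which case the coefficient of `X^k` in `f_p` is `a_{p^k}(G)`). -/
theorem stmt_3 (G : Type*) [Group G] [Finite G] :
    Group.IsNilpotent G ↔
      ∀ m n : ℕ, Nat.Coprime m n → subCount G (m * n) = subCount G m * subCount G n := by
  refine ⟨fun hG m n hmn ↦ hG.subCount_mul hmn, fun h ↦ ?_⟩
  refine ((Group.isNilpotent_of_finite_tfae (G := G)).out 0 3).mpr fun p hp P ↦ ?_
  have : Fact p.Prime := hp
  refine Subgroup.normal_of_subCount_eq_one _
    (Nat.eq_one_of_mul_eq_one_right (n := subCount G (P : Subgroup G).index) ?_)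
  rw [← h _ _ P.card_coprime_index, Subgroup.card_mul_index, subCount_natCard]
end

section
/- Let N be a positive integer such that v_p(N) ≤ 2 for every odd prime p and v_2(N) ≤ 3. If G and G' are nilpotent groups of order N with a_m(G) = a_m(G') for every natural number m, then G and G' are isomorphic. (That is, nilpotent groups of such orders are determined up to isomorphism by their zeta functions.) -/
theorem subCount_congr {G G' : Type*} [Group G] [Group G'] (e : G ≃* G') (m : ℕ) :
    subCount G m = subCount G' m :=
  Nat.card_congr <| e.mapSubgroup.toEquiv.subtypeEquiv fun H => by
    rw [Nat.card_congr (e.subgroupMap H).toEquiv]; rfl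

/-- Subgroups of `p`-power order of a group with a normal Sylow `p`-subgroup `P` lie in `P`. -/
theorem subCount_sylow {G : Type*} [Group G] [Finite G] {p : ℕ} [Fact p.Prime]
    (P : Sylow p G) [hP : (P : Subgroup G).Normal] (k : ℕ) :
    subCount (P : Subgroup G) (p ^ k) = subCount G (p ^ k) := by
  have hcard (H : Subgroup (P : Subgroup G)) :
      Nat.card (H.map (P : Subgroup G).subtype) = Nat.card H :=
    (Nat.card_congr (H.equivMapOfInjective _ (Subgroup.subtype_injective _)).toEquiv).symm
  refine Nat.card_congr (Equiv.ofBijective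
    (fun H => ⟨H.1.map (P : Subgroup G).subtype, (hcard _).trans H.2⟩) ⟨?_, ?_⟩)
  · intro H K hHK
    exact Subtype.ext (Subgroup.map_injective (Subgroup.subtype_injective _)
      (congrArg Subtype.val hHK))
  · rintro ⟨K, hK⟩
    have := P.unique_of_normal hP
    obtain ⟨Q, hQ⟩ := (IsPGroup.of_card hK).exists_le_sylow
    have hKP : K ≤ P := by rwa [Subsingleton.elim Q P] at hQ
    have hmap : (K.subgroupOf P).map (P : Subgroup G).subtype = K := by
      rw [Subgroup.subgroupOf_map_subtype, inf_eq_left.2 hKP]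
    exact ⟨⟨K.subgroupOf P, by rw [← hcard, hmap, hK]⟩, Subtype.ext hmap⟩

theorem IsCyclic.subCount_le_one {G : Type*} [Group G] [Finite G] [IsCyclic G] (m : ℕ) :
    subCount G m ≤ 1 := by
  classical
  have := Fintype.ofFinite G
  rw [subCount, Finite.card_le_one_iff_subsingleton]
  suffices h : ∀ H : Subgroup G, Nat.card H = m → (H : Set G) = {x | x ^ m = 1} from
    ⟨fun H K => Subtype.ext (SetLike.coe_injective ((h _ H.2).trans (h _ K.2).symm))⟩
  intro H hH
  have hle := IsCyclic.card_pow_eq_one_le (α := G) (hH ▸ Nat.card_pos : 0 < m)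
  refine Set.eq_of_subset_of_ncard_le (fun x hx => ?_) ?_ (Set.toFinite _)
  · have := pow_card_eq_one' (x := (⟨x, hx⟩ : H))
    rw [hH] at this
    exact congrArg Subtype.val this
  · calc _ ≤ m := by simpa [Set.ncard_eq_toFinset_card'] using hle
      _ = _ := by rw [← hH]; rfl

theorem isCyclic_of_subCount_le_one {G : Type*} [Group G] {p n : ℕ} [Fact p.Prime]
    (hG : Nat.card G = p ^ (n + 1)) (h : subCount G (p ^ n) ≤ 1) : IsCyclic G := by
  have hp : p.Prime := Fact.out
  have : Finite G := Nat.finite_of_card_ne_zero (hG ▸ pow_ne_zero _ hp.ne_zero)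
  rw [subCount, Finite.card_le_one_iff_subsingleton] at h
  obtain ⟨M, hM⟩ := Sylow.exists_subgroup_card_pow_prime (G := G) p (n := n)
    (hG ▸ pow_dvd_pow p n.le_succ)
  have hMtop : M ≠ ⊤ := by
    rintro rfl
    rw [Subgroup.card_top, hG] at hM
    exact absurd (Nat.pow_right_injective hp.two_le hM) (by omega)
  obtain ⟨x, hx⟩ : ∃ x, x ∉ M := by
    by_contra! hc
    exact hMtop ((Subgroup.eq_top_iff' M).2 hc)
  obtain ⟨k, hk, hk'⟩ := (Nat.dvd_prime_pow hp).1 (hG ▸ orderOf_dvd_natCard x)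
  by_cases hkn : k ≤ n
  · obtain ⟨K, hK, hxK⟩ := Sylow.exists_subgroup_card_pow_prime_le (G := G) p
      (hG ▸ pow_dvd_pow p n.le_succ) (Subgroup.zpowers x) ((Nat.card_zpowers x).trans hk') hkn
    have hKM : K = M := congrArg Subtype.val (h.elim ⟨K, hK⟩ ⟨M, hM⟩)
    exact absurd (hKM ▸ hxK (Subgroup.mem_zpowers x)) hx
  · exact isCyclic_of_orderOf_eq_card x (by rw [hk', hG, show k = n + 1 by omega])

/-- The coefficient at `p ^ n` detects cyclicity of groups of order `p ^ (n + 1)`. -/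
theorem isCyclic_iff_subCount_le_one {G : Type*} [Group G] {p n : ℕ} [Fact p.Prime]
    (hG : Nat.card G = p ^ (n + 1)) : IsCyclic G ↔ subCount G (p ^ n) ≤ 1 := by
  have : Finite G :=
    Nat.finite_of_card_ne_zero (hG ▸ pow_ne_zero _ (Fact.out : p.Prime).ne_zero)
  exact ⟨fun _ => IsCyclic.subCount_le_one _, isCyclic_of_subCount_le_one hG⟩

theorem ZMod.nonempty_linearEquiv_of_card_eq (p : ℕ) [Fact p.Prime] {V V' : Type*}
    [AddCommGroup V] [AddCommGroup V'] [Finite V] [Finite V'] [Module (ZMod p) V]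
    [Module (ZMod p) V'] (hcard : Nat.card V = Nat.card V') : Nonempty (V ≃ₗ[ZMod p] V') := by
  have h1 := FiniteField.pow_finrank_eq_natCard p V
  have h2 := FiniteField.pow_finrank_eq_natCard p V'
  exact FiniteDimensional.nonempty_linearEquiv_of_finrank_eq
    (Nat.pow_right_injective (Fact.out : p.Prime).two_le (h1.trans (hcard.trans h2.symm)))

/-- Elementary abelian `p`-groups of equal order are isomorphic. -/
theorem nonempty_mulEquiv_of_pow_prime_eq_one {G G' : Type*} [CommGroup G] [CommGroup G']
    [Finite G] [Finite G'] {p : ℕ} [Fact p.Prime] (hG : ∀ x : G, x ^ p = 1)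
    (hG' : ∀ x : G', x ^ p = 1) (hcard : Nat.card G = Nat.card G') : Nonempty (G ≃* G') := by
  let : Module (ZMod p) (Additive G) := AddCommGroup.zmodModule fun x => hG x.toMul
  let : Module (ZMod p) (Additive G') := AddCommGroup.zmodModule fun x => hG' x.toMul
  obtain ⟨e⟩ := ZMod.nonempty_linearEquiv_of_card_eq p (V := Additive G) (V' := Additive G') hcard
  exact ⟨MulEquiv.toAdditive.symm e.toAddEquiv⟩

theorem pow_prime_pow_eq_one {G : Type*} [Group G] {p n : ℕ} [Fact p.Prime]
    (hG : Nat.card G = p ^ (n + 1)) (hc : ¬ IsCyclic G) (x : G) : x ^ p ^ n = 1 := by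
  obtain ⟨k, hk, hx⟩ := (Nat.dvd_prime_pow Fact.out).1 (hG ▸ orderOf_dvd_natCard x)
  have : Finite G := Nat.finite_of_card_ne_zero (hG ▸ pow_ne_zero _ (Fact.out : p.Prime).ne_zero)
  have hk' : k ≠ n + 1 := by
    rintro rfl
    exact hc (isCyclic_of_orderOf_eq_card x (by rw [hx, hG]))
  exact orderOf_dvd_iff_pow_eq_one.1 (hx ▸ pow_dvd_pow p (by omega : k ≤ n))

theorem nonempty_mulEquiv_of_card_eq_prime_sq {G G' : Type*} [Group G] [Group G'] {p : ℕ}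
    [Fact p.Prime] (hG : Nat.card G = p ^ 2) (hG' : Nat.card G' = p ^ 2)
    (hc : ¬ IsCyclic G) (hc' : ¬ IsCyclic G') : Nonempty (G ≃* G') := by
  have h0 : p ^ 2 ≠ 0 := pow_ne_zero _ (Fact.out : p.Prime).ne_zero
  have := Nat.finite_of_card_ne_zero (hG ▸ h0)
  have := Nat.finite_of_card_ne_zero (hG' ▸ h0)
  let := IsPGroup.commGroupOfCardEqPrimeSq hG
  let := IsPGroup.commGroupOfCardEqPrimeSq hG'
  exact nonempty_mulEquiv_of_pow_prime_eq_one (by simpa using pow_prime_pow_eq_one hG hc)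
    (by simpa using pow_prime_pow_eq_one hG' hc') (hG.trans hG'.symm)

theorem exists_pow_eq_of_mem_zpowers {G : Type*} [Group G] {x y : G} {n : ℕ} (hn : 0 < n)
    (hx : orderOf x = n) (hy : y ∈ Subgroup.zpowers x) : ∃ k < n, x ^ k = y := by
  classical
  subst hx
  simpa using ((orderOf_pos_iff.1 hn).mem_zpowers_iff_mem_range_orderOf).1 hy

theorem subCount_two (G : Type*) [Group G] :
    subCount G 2 = Nat.card {g : G // g * g = 1 ∧ g ≠ 1} := by
  have hord (g : {g : G // g * g = 1 ∧ g ≠ 1}) : orderOf g.1 = 2 :=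
    orderOf_eq_prime (by rw [sq, g.2.1]) g.2.2
  refine (Nat.card_congr (Equiv.ofBijective
    (fun g => ⟨Subgroup.zpowers g.1, (Nat.card_zpowers _).trans (hord g)⟩) ⟨?_, ?_⟩)).symm
  · intro g g' hgg
    have hmem : g.1 ∈ Subgroup.zpowers g'.1 := by
      rw [← show Subgroup.zpowers g.1 = Subgroup.zpowers g'.1 from congrArg Subtype.val hgg]
      exact Subgroup.mem_zpowers g.1
    obtain ⟨k, hk, hkg⟩ := exists_pow_eq_of_mem_zpowers two_pos (hord g') hmem
    interval_cases k
    · exact absurd (by simpa using hkg.symm) g.2.2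
    · exact Subtype.ext (by simpa using hkg.symm)
  · rintro ⟨H, hH⟩
    have : Finite H := Nat.finite_of_card_ne_zero (by omega)
    obtain ⟨g, hg⟩ := exists_prime_orderOf_dvd_card' (G := H) 2 hH.symm.dvd
    have ho : orderOf g.1 = 2 := (Subgroup.orderOf_coe g).trans hg
    refine ⟨⟨g, by rw [← sq, ← ho, pow_orderOf_eq_one], fun h => by simp [h] at ho⟩,
      Subtype.ext ?_⟩
    exact Subgroup.eq_of_le_of_card_ge (by simp) (by rw [Nat.card_zpowers, ho, hH])

section ZModPow

variable {G : Type*} [Group G] {n : ℕ} [NeZero n] {x : G}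

theorem pow_val_add (hx : x ^ n = 1) (i j : ZMod n) :
    x ^ (i + j).val = x ^ i.val * x ^ j.val := by
  rw [ZMod.val_add, ← pow_eq_pow_mod _ hx, pow_add]

theorem pow_val_sub (hx : x ^ n = 1) (i j : ZMod n) :
    x ^ (i - j).val = x ^ i.val * (x ^ j.val)⁻¹ := by
  rw [eq_mul_inv_iff_mul_eq, ← pow_val_add hx, sub_add_cancel]

end ZModPow

theorem pow_mul_of_semiconj_inv {G : Type*} [Group G] {x y : G} (h : x * y = y * x⁻¹) (k : ℕ) :
    x ^ k * y = y * (x ^ k)⁻¹ := by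
  have : SemiconjBy y x⁻¹ x := h.symm
  simpa using (this.pow_right k).eq.symm

theorem nonempty_mulEquiv_of_zpowers_index_two {K G : Type*} [Group K] [Group G] [Finite G]
    (f : K →* G) (hcard : Nat.card K = Nat.card G) {x y : G}
    (hx : (Subgroup.zpowers x).index = 2) (hy : y ∉ Subgroup.zpowers x)
    (hxf : x ∈ f.range) (hyf : y ∈ f.range) : Nonempty (K ≃* G) := by
  have hle : Subgroup.zpowers x ≤ f.range := by simpa using hxf
  have htop : f.range = ⊤ := by
    rw [← Subgroup.index_eq_one]
    have hmul := Subgroup.relIndex_mul_index hle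
    rw [hx] at hmul
    rcases (Nat.dvd_prime Nat.prime_two).1 (Dvd.intro_left _ hmul) with h | h
    · exact h
    · have : (Subgroup.zpowers x).relIndex f.range = 1 := by rw [h] at hmul; omega
      exact absurd (Subgroup.relIndex_eq_one.1 this hyf) hy
  have : Finite K := Nat.finite_of_card_ne_zero (hcard ▸ Nat.card_pos.ne')
  exact ⟨MulEquiv.ofBijective f ((Nat.bijective_iff_surjective_and_card f).2
    ⟨MonoidHom.range_eq_top.1 htop, hcard⟩)⟩

theorem nonempty_dihedralGroup_mulEquiv {G : Type*} [Group G] {n : ℕ} [NeZero n]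
    (hG : Nat.card G = 2 * n) {x y : G} (hx : orderOf x = n) (hy : y ∉ Subgroup.zpowers x)
    (hyy : y * y = 1) (hxy : x * y = y * x⁻¹) : Nonempty (DihedralGroup n ≃* G) := by
  have hn := NeZero.pos n
  have : Finite G := Nat.finite_of_card_ne_zero (by omega)
  have hxn : x ^ n = 1 := hx ▸ pow_orderOf_eq_one x
  have hxi : (Subgroup.zpowers x).index = 2 := by
    have := (Subgroup.zpowers x).card_mul_index
    rw [Nat.card_zpowers, hx, hG, mul_comm] at this
    exact Nat.eq_of_mul_eq_mul_right hn this
  have hc (i : ZMod n) : x ^ i.val * y = y * (x ^ i.val)⁻¹ := pow_mul_of_semiconj_inv hxy _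
  let f : DihedralGroup n →* G := MonoidHom.mk' (fun
      | .r i => x ^ i.val
      | .sr i => y * x ^ i.val) (by
    rintro (i | i) (j | j)
    · simp [pow_val_add hxn]
    · simp only [DihedralGroup.r_mul_sr, pow_val_sub hxn]
      rw [(Commute.pow_pow_self x _ _).inv_right.eq, ← mul_assoc, ← hc, mul_assoc]
    · simp [pow_val_add hxn, mul_assoc]
    · simp only [DihedralGroup.sr_mul_sr, pow_val_sub hxn]
      rw [mul_assoc, ← mul_assoc _ y, hc, mul_assoc, ← mul_assoc y, hyy, one_mul,
        (Commute.pow_pow_self x _ _).inv_right.eq])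
  refine nonempty_mulEquiv_of_zpowers_index_two f (by rw [DihedralGroup.nat_card, hG]) hxi hy
    ⟨.r 1, ?_⟩ ⟨.sr 0, ?_⟩
  · change x ^ (1 : ZMod n).val = x
    rw [ZMod.val_one_eq_one_mod, ← pow_eq_pow_mod _ hxn, pow_one]
  · change y * x ^ (0 : ZMod n).val = y
    simp

theorem nonempty_quaternionGroup_mulEquiv {G : Type*} [Group G] {n : ℕ} [NeZero n]
    (hG : Nat.card G = 4 * n) {x y : G} (hx : orderOf x = 2 * n) (hy : y ∉ Subgroup.zpowers x)
    (hyy : y * y = x ^ n) (hxy : x * y = y * x⁻¹) : Nonempty (QuaternionGroup n ≃* G) := by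
  have hn := NeZero.pos n
  have : Finite G := Nat.finite_of_card_ne_zero (by omega)
  have hxn : x ^ (2 * n) = 1 := hx ▸ pow_orderOf_eq_one x
  have hxi : (Subgroup.zpowers x).index = 2 := by
    have := (Subgroup.zpowers x).card_mul_index
    rw [Nat.card_zpowers, hx, hG, mul_comm] at this
    exact Nat.eq_of_mul_eq_mul_right (by omega : 0 < 2 * n) (by omega)
  have hc (i : ZMod (2 * n)) : x ^ i.val * y = y * (x ^ i.val)⁻¹ :=
    pow_mul_of_semiconj_inv hxy _
  have hval : x ^ (n : ZMod (2 * n)).val = x ^ n := by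
    rw [ZMod.val_natCast, ← pow_eq_pow_mod _ hxn]
  let f : QuaternionGroup n →* G := MonoidHom.mk' (fun
      | .a i => x ^ i.val
      | .xa i => y * x ^ i.val) (by
    rintro (i | i) (j | j)
    · simp [pow_val_add hxn]
    · simp only [QuaternionGroup.a_mul_xa, pow_val_sub hxn]
      rw [(Commute.pow_pow_self x _ _).inv_right.eq, ← mul_assoc, ← hc, mul_assoc]
    · simp [pow_val_add hxn, mul_assoc]
    · simp only [QuaternionGroup.xa_mul_xa, pow_val_sub hxn, pow_val_add hxn, hval]
      rw [mul_assoc y, ← mul_assoc _ y, hc, mul_assoc y, ← mul_assoc y, hyy, mul_assoc,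
        (Commute.pow_pow_self x _ _).inv_right.eq])
  refine nonempty_mulEquiv_of_zpowers_index_two f
    (by rw [Nat.card_eq_fintype_card, QuaternionGroup.card, hG]) hxi hy ⟨.a 1, ?_⟩ ⟨.xa 0, ?_⟩
  · change x ^ (1 : ZMod (2 * n)).val = x
    rw [ZMod.val_one_eq_one_mod, ← pow_eq_pow_mod _ hxn, pow_one]
  · change y * x ^ (0 : ZMod (2 * n)).val = y
    simp

theorem nonempty_zmod_prod_zmod_two_mulEquiv {G : Type*} [Group G] {n : ℕ} [NeZero n]
    (hG : Nat.card G = 2 * n) {x y : G} (hx : orderOf x = n) (hy : y ∉ Subgroup.zpowers x)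
    (hyy : y * y = 1) (hxy : Commute x y) :
    Nonempty (Multiplicative (ZMod n × ZMod 2) ≃* G) := by
  have hn := NeZero.pos n
  have : Finite G := Nat.finite_of_card_ne_zero (by omega)
  have hxn : x ^ n = 1 := hx ▸ pow_orderOf_eq_one x
  have hy2 : y ^ 2 = 1 := by rw [sq, hyy]
  have hxi : (Subgroup.zpowers x).index = 2 := by
    have := (Subgroup.zpowers x).card_mul_index
    rw [Nat.card_zpowers, hx, hG, mul_comm] at this
    exact Nat.eq_of_mul_eq_mul_right hn this
  let f : Multiplicative (ZMod n × ZMod 2) →* G := MonoidHom.mk'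
    (fun a => x ^ a.toAdd.1.val * y ^ a.toAdd.2.val) (by
      intro a b
      simp only [toAdd_mul, Prod.fst_add, Prod.snd_add, pow_val_add hxn, pow_val_add hy2]
      exact ((hxy.symm.pow_pow _ _).mul_mul_mul_comm _ _).symm)
  refine nonempty_mulEquiv_of_zpowers_index_two f ?_ hxi hy
    ⟨.ofAdd (1, 0), ?_⟩ ⟨.ofAdd (0, 1), ?_⟩
  · rw [Nat.card_congr Multiplicative.toAdd, Nat.card_prod, Nat.card_zmod, Nat.card_zmod, hG,
      mul_comm]
  · change x ^ (1 : ZMod n).val * y ^ (0 : ZMod 2).val = x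
    rw [ZMod.val_one_eq_one_mod, ← pow_eq_pow_mod _ hxn, pow_one, ZMod.val_zero, pow_zero,
      mul_one]
  · change x ^ (0 : ZMod n).val * y ^ (1 : ZMod 2).val = y
    simp [ZMod.val_one]

/-- Classification of the noncyclic groups of order eight with an element of order four. -/
theorem nonempty_mulEquiv_of_card_eq_eight {G : Type*} [Group G] (hG : Nat.card G = 8)
    (hc : ¬ IsCyclic G) {x : G} (hx : orderOf x = 4) :
    Nonempty (Multiplicative (ZMod 4 × ZMod 2) ≃* G) ∨ Nonempty (DihedralGroup 4 ≃* G) ∨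
      Nonempty (QuaternionGroup 2 ≃* G) := by
  have : Finite G := Nat.finite_of_card_ne_zero (by omega)
  have hx4 : x ^ 4 = 1 := hx ▸ pow_orderOf_eq_one x
  have hxi : (Subgroup.zpowers x).index = 2 := by
    have := (Subgroup.zpowers x).card_mul_index
    rw [Nat.card_zpowers, hx, hG] at this
    omega
  obtain ⟨y, hy⟩ : ∃ y, y ∉ Subgroup.zpowers x := by
    by_contra! h
    simp [(Subgroup.eq_top_iff' _).2 h] at hxi
  have hy4 : y ^ 4 = 1 := by
    have : Fact (Nat.Prime 2) := ⟨Nat.prime_two⟩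
    exact pow_prime_pow_eq_one (p := 2) (n := 2) hG hc y
  have hyx : ∃ k < 4, x ^ k = y * y := exists_pow_eq_of_mem_zpowers (by norm_num) hx
    (Subgroup.mul_self_mem_of_index_two hxi y)
  have hyy : y * y = 1 ∨ y * y = x ^ 2 := by
    obtain ⟨k, hk, h⟩ := hyx
    have h2 : x ^ (k * 2) = 1 := by rw [pow_mul, h, ← sq, ← pow_mul, hy4]
    have := orderOf_dvd_of_pow_eq_one h2
    rw [hx] at this
    have : k = 0 ∨ k = 2 := by omega
    rcases this with rfl | rfl
    · left; simpa using h.symm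
    · right; exact h.symm
  have hconj : Commute x y ∨ x * y = y * x⁻¹ := by
    have := Subgroup.normal_of_index_eq_two hxi
    obtain ⟨k, hk, h⟩ := exists_pow_eq_of_mem_zpowers (by norm_num) hx
      (this.conj_mem' x (Subgroup.mem_zpowers x) y)
    have ho : orderOf (x ^ k) = 4 := by
      rw [h, ← hx]
      simpa using (MulAut.conj y⁻¹).orderOf_eq x
    have hxy : x * y = y * x ^ k := by rw [h]; group
    interval_cases k
    · simp at ho
    · left; simpa [commute_iff_eq] using hxy
    · rw [orderOf_pow, hx] at ho
      norm_num at ho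
    · right
      rw [hxy, mul_right_inj, eq_inv_iff_mul_eq_one, ← pow_succ, hx4]
  rcases hconj with hxy | hxy
  · left
    rcases hyy with hyy | hyy
    · exact nonempty_zmod_prod_zmod_two_mulEquiv hG hx hy hyy hxy
    · refine nonempty_zmod_prod_zmod_two_mulEquiv (y := x * y) hG hx
        (fun h => hy ((Subgroup.mul_mem_cancel_left _ (Subgroup.mem_zpowers x)).1 h)) ?_
        ((Commute.refl x).mul_right hxy)
      rw [hxy.symm.mul_mul_mul_comm, hyy, ← hx4]
      group
  · right
    rcases hyy with hyy | hyy
    · exact .inl (nonempty_dihedralGroup_mulEquiv hG hx hy hyy hxy)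
    · exact .inr (nonempty_quaternionGroup_mulEquiv hG hx hy hyy hxy)

theorem subCount_two_zmod_four_prod_zmod_two :
    subCount (Multiplicative (ZMod 4 × ZMod 2)) 2 = 3 := by
  rw [subCount_two, Nat.card_eq_fintype_card]
  decide

theorem subCount_two_dihedralGroup_four : subCount (DihedralGroup 4) 2 = 5 := by
  rw [subCount_two, Nat.card_eq_fintype_card]
  decide

theorem subCount_two_quaternionGroup_two : subCount (QuaternionGroup 2) 2 = 1 := by
  rw [subCount_two, Nat.card_eq_fintype_card]
  decide

theorem subCount_two_of_sq_eq_one {G : Type*} [Group G] [Finite G] (h : ∀ x : G, x ^ 2 = 1) :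
    subCount G 2 = Nat.card G - 1 := by
  classical
  have := Fintype.ofFinite G
  rw [subCount_two, Nat.card_congr (Equiv.subtypeEquivRight fun g =>
    and_iff_right (by rw [← sq, h])), Nat.card_eq_fintype_card, Nat.card_eq_fintype_card]
  exact Set.card_ne_eq 1

theorem exists_orderOf_eq_four {G : Type*} [Group G] (hG : Nat.card G = 8) (hc : ¬ IsCyclic G)
    (h : ¬ ∀ x : G, x ^ 2 = 1) : ∃ x : G, orderOf x = 4 := by
  push Not at h
  obtain ⟨x, hx⟩ := h
  have : Fact (Nat.Prime 2) := ⟨Nat.prime_two⟩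
  exact ⟨x, orderOf_eq_prime_pow (p := 2) (n := 1) (by simpa using hx)
    (pow_prime_pow_eq_one (p := 2) (n := 2) hG hc x)⟩

theorem nonempty_mulEquiv_of_card_eq_eight_of_subCount {G G' : Type*} [Group G] [Group G']
    (hG : Nat.card G = 8) (hG' : Nat.card G' = 8) (hc : ¬ IsCyclic G) (hc' : ¬ IsCyclic G')
    (h : subCount G 2 = subCount G' 2) : Nonempty (G ≃* G') := by
  have : Finite G := Nat.finite_of_card_ne_zero (by omega)
  have : Finite G' := Nat.finite_of_card_ne_zero (by omega)
  have : Fact (Nat.Prime 2) := ⟨Nat.prime_two⟩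
  have h1 := subCount_two_zmod_four_prod_zmod_two
  have h2 := subCount_two_dihedralGroup_four
  have h3 := subCount_two_quaternionGroup_two
  by_cases hs : ∀ x : G, x ^ 2 = 1 <;> by_cases hs' : ∀ x : G', x ^ 2 = 1
  · let : CommGroup G :=
      { mul_comm := Commute.of_orderOf_dvd_two fun g => orderOf_dvd_of_pow_eq_one (hs g) }
    let : CommGroup G' :=
      { mul_comm := Commute.of_orderOf_dvd_two fun g => orderOf_dvd_of_pow_eq_one (hs' g) }
    exact nonempty_mulEquiv_of_pow_prime_eq_one hs hs' (hG.trans hG'.symm)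
  · have hn := subCount_two_of_sq_eq_one hs
    obtain ⟨x, hx⟩ := exists_orderOf_eq_four hG' hc' hs'
    rcases nonempty_mulEquiv_of_card_eq_eight hG' hc' hx with ⟨⟨e⟩⟩ | ⟨⟨e⟩⟩ | ⟨⟨e⟩⟩ <;>
    · have := subCount_congr e 2
      omega
  · have hn := subCount_two_of_sq_eq_one hs'
    obtain ⟨x, hx⟩ := exists_orderOf_eq_four hG hc hs
    rcases nonempty_mulEquiv_of_card_eq_eight hG hc hx with ⟨⟨e⟩⟩ | ⟨⟨e⟩⟩ | ⟨⟨e⟩⟩ <;>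
    · have := subCount_congr e 2
      omega
  · obtain ⟨x, hx⟩ := exists_orderOf_eq_four hG hc hs
    obtain ⟨x', hx'⟩ := exists_orderOf_eq_four hG' hc' hs'
    rcases nonempty_mulEquiv_of_card_eq_eight hG hc hx with ⟨⟨e⟩⟩ | ⟨⟨e⟩⟩ | ⟨⟨e⟩⟩ <;>
    rcases nonempty_mulEquiv_of_card_eq_eight hG' hc' hx' with ⟨⟨e'⟩⟩ | ⟨⟨e'⟩⟩ | ⟨⟨e'⟩⟩ <;>
    first
    | exact ⟨e.symm.trans e'⟩
    | have := subCount_congr e 2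
      have := subCount_congr e' 2
      omega

/-- Groups of order `p ^ n` with `n ≤ 2`, or `n ≤ 3` and `p = 2`, are determined by their
subgroup counts. -/
theorem nonempty_mulEquiv_of_card_eq_prime_pow {G G' : Type*} [Group G] [Group G'] {p n : ℕ}
    [Fact p.Prime] (hn : n ≤ 2 ∨ p = 2 ∧ n ≤ 3) (hG : Nat.card G = p ^ n)
    (hG' : Nat.card G' = p ^ n) (h : ∀ k, subCount G (p ^ k) = subCount G' (p ^ k)) :
    Nonempty (G ≃* G') := by
  have hcard := hG.trans hG'.symm
  have hiff : IsCyclic G ↔ IsCyclic G' := by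
    rcases n with _ | n
    · have := (Nat.card_eq_one_iff_unique.1 hG).1
      have := (Nat.card_eq_one_iff_unique.1 hG').1
      exact ⟨fun _ => inferInstance, fun _ => inferInstance⟩
    · rw [isCyclic_iff_subCount_le_one hG, isCyclic_iff_subCount_le_one hG', h]
  by_cases hc : IsCyclic G
  · have := hiff.1 hc
    exact ⟨mulEquivOfCyclicCardEq hcard⟩
  have hc' := hiff.not.1 hc
  have : n = 2 ∨ p = 2 ∧ n = 3 := by
    by_contra hne
    have : n = 0 ∨ n = 1 := by omega
    rcases this with rfl | rfl
    · have := (Nat.card_eq_one_iff_unique.1 hG).1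
      exact hc inferInstance
    · exact hc (isCyclic_of_prime_card (hG.trans (pow_one p)))
  rcases this with rfl | ⟨rfl, rfl⟩
  · exact nonempty_mulEquiv_of_card_eq_prime_sq hG hG' hc hc'
  · exact nonempty_mulEquiv_of_card_eq_eight_of_subCount hG hG' hc hc' (by simpa using h 1)

/-- A finite nilpotent group is the product of any choice of its Sylow subgroups. -/
theorem nonempty_pi_sylow_mulEquiv {G : Type*} [Group G] [Finite G] [Group.IsNilpotent G]
    {N : ℕ} (hG : Nat.card G = N) (P : ∀ p : N.primeFactors, Sylow p G) :
    Nonempty ((∀ p, (P p : Subgroup G)) ≃* G) := by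
  subst hG
  have (p : (Nat.card G).primeFactors) : Fact (p : ℕ).Prime :=
    ⟨Nat.prime_of_mem_primeFactors p.2⟩
  let (p : (Nat.card G).primeFactors) : Unique (Sylow p G) :=
    { default := P p
      uniq := fun Q => by
        have := (P p).unique_of_normal inferInstance
        exact Subsingleton.elim _ _ }
  exact ⟨(MulEquiv.piCongrRight fun p => (MulEquiv.piUnique fun Q : Sylow p G => Q).symm).trans
    (Sylow.directProductOfNormal inferInstance)⟩

/-- If `N` is a positive integer with `v_p(N) ≤ 2` for every odd prime `p` and
`v_2(N) ≤ 3`, then nilpotent groups of order `N` are determined up to isomorphism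
by their zeta functions. -/
theorem stmt_8 (N : ℕ) (hN : 0 < N)
    (hodd : ∀ p : ℕ, p.Prime → Odd p → N.factorization p ≤ 2)
    (h2 : N.factorization 2 ≤ 3)
    (G G' : Type*) [Group G] [Group G'] [Finite G] [Finite G']
    [Group.IsNilpotent G] [Group.IsNilpotent G']
    (hG : Nat.card G = N) (hG' : Nat.card G' = N)
    (h : ∀ m : ℕ, subCount G m = subCount G' m) :
    Nonempty (G ≃* G') := by
  let P : ∀ p : N.primeFactors, Sylow p G := default
  let P' : ∀ p : N.primeFactors, Sylow p G' := default
  have key (p : N.primeFactors) : Nonempty ((P p : Subgroup G) ≃* (P' p : Subgroup G')) := by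
    have hp : (p : ℕ).Prime := Nat.prime_of_mem_primeFactors p.2
    have : Fact (p : ℕ).Prime := ⟨hp⟩
    refine nonempty_mulEquiv_of_card_eq_prime_pow (p := p) (n := N.factorization p) ?_
      (hG ▸ (P p).card_eq_multiplicity) (hG' ▸ (P' p).card_eq_multiplicity) fun k => by
        rw [subCount_sylow, subCount_sylow, h]
    rcases hp.eq_two_or_odd' with h' | h'
    · exact .inr ⟨h', by rwa [h']⟩
    · exact .inl (hodd p hp h')
  obtain ⟨e⟩ := nonempty_pi_sylow_mulEquiv hG P
  obtain ⟨e'⟩ := nonempty_pi_sylow_mulEquiv hG' P'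
  exact ⟨e.symm.trans ((MulEquiv.piCongrRight fun p => (key p).some).trans e')⟩
end

section
/- Let G and G' be finite abelian groups such that a_m(G) = a_m(G') for every natural number m (i.e., G and G' have the same zeta function). Then G and G' are isomorphic. In other words, within finite abelian groups, the zeta function ζ_G(s) determines the isomorphism class of G. -/
open Finset in
/-- Families of pairs `(p i, e i)` and `(p' k, e' k)` such that for all `q` and `j` the first one
has at most as many members with `p i = q` and `e i > j` as the second: the members of the first
one with `e i > 0` can be matched injectively with members of the second one having the same
first component and a second component at least as large. -/
theorem exists_injective_matching_of_card_le {ι κ : Type*} [Fintype ι] [Fintype κ]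
    (p e : ι → ℕ) (p' e' : κ → ℕ)
    (h : ∀ q j, #{i | p i = q ∧ j + 1 ≤ e i} ≤ #{k | p' k = q ∧ j + 1 ≤ e' k}) :
    ∃ σ : {i // 0 < e i} → κ, Function.Injective σ ∧
      ∀ i, p' (σ i) = p i ∧ e i ≤ e' (σ i) := by
  classical
  have key (q : ℕ) : ∃ f : {i // p i = q ∧ 0 < e i} → κ, Function.Injective f ∧
      ∀ i, p' (f i) = q ∧ e i ≤ e' (f i) := by
    refine (Fintype.all_card_le_filter_rel_iff_exists_injective
      (fun (i : {i // p i = q ∧ 0 < e i}) k => p' k = q ∧ e i ≤ e' k)).1 fun A => ?_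
    rcases A.eq_empty_or_nonempty with rfl | hA
    · simp
    obtain ⟨m, hmA, hm⟩ := A.exists_min_image (fun i => e i) hA
    obtain ⟨j, hj⟩ := Nat.exists_eq_add_of_lt m.2.2
    rw [zero_add] at hj
    calc #A = #(A.map (Function.Embedding.subtype _)) := (card_map _).symm
      _ ≤ #{i | p i = q ∧ j + 1 ≤ e i} := by
        refine card_le_card fun i hi => ?_
        obtain ⟨a, ha, rfl⟩ := mem_map.1 hi
        exact mem_filter.2 ⟨mem_univ _, a.2.1, hj ▸ hm a ha⟩
      _ ≤ #{k | p' k = q ∧ j + 1 ≤ e' k} := h q j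
      _ ≤ _ := by
        refine card_le_card fun k hk => ?_
        simp only [mem_filter, mem_univ, true_and] at hk ⊢
        exact ⟨m, hmA, hk.1, hj ▸ hk.2⟩
  choose f hf hfr using key
  refine ⟨fun i => f (p i) ⟨i, rfl, i.2⟩, fun a b hab => ?_, fun i => hfr _ _⟩
  obtain ⟨a, ha⟩ := a
  obtain ⟨b, hb⟩ := b
  have hp : p a = p b := by
    rw [← (hfr (p a) ⟨a, rfl, ha⟩).1, ← (hfr (p b) ⟨b, rfl, hb⟩).1]
    exact congrArg p' hab
  have hab' : f (p b) ⟨a, hp, ha⟩ = f (p b) ⟨b, rfl, hb⟩ := by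
    have hcast (q) (h : p a = q) : f q ⟨a, h, ha⟩ = f (p a) ⟨a, rfl, ha⟩ := by
      subst h
      rfl
    exact (hcast _ hp).trans hab
  simpa using hf _ hab'

namespace CommGroup

/-- Finite abelian groups are products of cyclic groups of prime power order. -/
theorem exists_mulEquiv_pi_zmod_prime_pow (G : Type*) [CommGroup G] [Finite G] :
    ∃ (ι : Type) (_ : Fintype ι) (p : ι → ℕ) (_ : ∀ i, (p i).Prime) (e : ι → ℕ),
      Nonempty (G ≃* ((i : ι) → Multiplicative (ZMod (p i ^ e i)))) := by
  classical
  obtain ⟨ι, hι, p, hp, e, ⟨f⟩⟩ := AddCommGroup.equiv_directSum_zmod_of_finite (Additive G)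
  exact ⟨ι, hι, p, hp, e, ⟨MulEquiv.toAdditive.symm <| f.trans <|
    (DirectSum.addEquivProd _).trans (MulEquiv.piMultiplicative _).toAdditiveRight⟩⟩

theorem exists_injective_zmod_hom_of_dvd {a b : ℕ} (hb : b ≠ 0) (hab : a ∣ b) :
    ∃ f : Multiplicative (ZMod a) →* Multiplicative (ZMod b), Function.Injective f := by
  obtain ⟨c, rfl⟩ := hab
  have hc : (c : ℤ) ≠ 0 := by
    rintro h
    simp_all
  let g : ZMod a →+ ZMod (a * c) := ZMod.lift a ⟨zmultiplesHom _ (c : ZMod (a * c)), by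
    simp [← Nat.cast_mul]⟩
  refine ⟨AddMonoidHom.toMultiplicative g, ?_⟩
  change Function.Injective g
  refine (ZMod.lift_injective _).2 fun m hm => ?_
  have : ((m * c : ℤ) : ZMod (a * c)) = 0 := by simpa using hm
  rw [ZMod.intCast_zmod_eq_zero_iff_dvd] at *
  push_cast at this
  exact Int.dvd_of_mul_dvd_mul_right hc this

theorem card_powMonoidHom_ker_congr {G H : Type*} [CommGroup G] [CommGroup H] (f : G ≃* H)
    (n : ℕ) :
    Nat.card (powMonoidHom n : G →* G).ker = Nat.card (powMonoidHom n : H →* H).ker := by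
  refine Nat.card_congr (f.toEquiv.subtypeEquiv fun x => ?_)
  simp [MonoidHom.mem_ker, ← map_pow]

theorem card_powMonoidHom_ker_pi {ι : Type*} [Fintype ι] (M : ι → Type*)
    [∀ i, CommGroup (M i)] (n : ℕ) :
    Nat.card (powMonoidHom n : (∀ i, M i) →* (∀ i, M i)).ker =
      ∏ i, Nat.card (powMonoidHom n : M i →* M i).ker := by
  rw [← Nat.card_pi]
  refine Nat.card_congr ((Equiv.subtypeEquivRight fun x => ?_).trans Equiv.subtypePiEquivPi)
  simp [MonoidHom.mem_ker, funext_iff]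

theorem gcd_prime_pow_succ {p q : ℕ} (hp : p.Prime) (hq : q.Prime) (e j : ℕ) :
    (p ^ e).gcd (q ^ (j + 1)) =
      (p ^ e).gcd (q ^ j) * if p = q ∧ j + 1 ≤ e then q else 1 := by
  by_cases h : p = q
  · subst h
    by_cases he : j + 1 ≤ e
    · rw [Nat.gcd_eq_right (pow_dvd_pow p he), Nat.gcd_eq_right (pow_dvd_pow p (by omega))]
      simp [he, pow_succ]
    · rw [Nat.gcd_eq_left (pow_dvd_pow p (by omega)), Nat.gcd_eq_left (pow_dvd_pow p (by omega))]
      simp [he]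
  · have hc := (Nat.coprime_primes hp hq).2 h
    rw [(hc.pow _ _).gcd_eq_one, (hc.pow _ _).gcd_eq_one]
    simp [h]

open Finset in
/-- In a product of cyclic groups of prime power order, the index of the `q ^ j`-torsion in the
`q ^ (j + 1)`-torsion counts the factors whose order is divisible by `q ^ (j + 1)`. -/
theorem card_powMonoidHom_ker_succ {G ι : Type*} [CommGroup G] [Fintype ι] {p e : ι → ℕ}
    (hp : ∀ i, (p i).Prime) (f : G ≃* ((i : ι) → Multiplicative (ZMod (p i ^ e i))))
    {q : ℕ} (hq : q.Prime) (j : ℕ) :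
    Nat.card (powMonoidHom (q ^ (j + 1)) : G →* G).ker =
      Nat.card (powMonoidHom (q ^ j) : G →* G).ker * q ^ #{i | p i = q ∧ j + 1 ≤ e i} := by
  have (i : ι) : NeZero (p i ^ e i) := ⟨pow_ne_zero _ (hp i).ne_zero⟩
  have (i : ι) : Finite (Multiplicative (ZMod (p i ^ e i))) :=
    inferInstanceAs (Finite (ZMod (p i ^ e i)))
  have hcard (n : ℕ) : Nat.card (powMonoidHom n : G →* G).ker = ∏ i, (p i ^ e i).gcd n := by
    rw [card_powMonoidHom_ker_congr f, card_powMonoidHom_ker_pi]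
    refine prod_congr rfl fun i _ => ?_
    rw [IsCyclic.card_powMonoidHom_ker]
    congr 1
    exact Nat.card_zmod _
  rw [hcard, hcard, prod_congr rfl fun i _ => gcd_prime_pow_succ (hp i) hq (e i) j,
    prod_mul_distrib, prod_ite]
  simp

/-- A finite abelian group embeds into another one as soon as, for all prime powers, the successive
quotients of its prime power torsion are at most as large. -/
theorem exists_injective_of_card_powMonoidHom_ker_le {G G' : Type*} [CommGroup G] [CommGroup G']
    [Finite G] [Finite G']
    (h : ∀ q j : ℕ, q.Prime →
      Nat.card (powMonoidHom (q ^ (j + 1)) : G →* G).ker *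
          Nat.card (powMonoidHom (q ^ j) : G' →* G').ker ≤
        Nat.card (powMonoidHom (q ^ (j + 1)) : G' →* G').ker *
          Nat.card (powMonoidHom (q ^ j) : G →* G).ker) :
    ∃ f : G →* G', Function.Injective f := by
  classical
  obtain ⟨ι, _, p, hp, e, ⟨f⟩⟩ := exists_mulEquiv_pi_zmod_prime_pow G
  obtain ⟨κ, _, p', hp', e', ⟨f'⟩⟩ := exists_mulEquiv_pi_zmod_prime_pow G'
  obtain ⟨σ, hσ, hσr⟩ := exists_injective_matching_of_card_le p e p' e' fun q j => by
    by_cases hq : q.Prime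
    · have hqj := h q j hq
      rw [card_powMonoidHom_ker_succ hp f hq, card_powMonoidHom_ker_succ hp' f' hq,
        mul_right_comm, mul_right_comm _ _ (Nat.card _),
        mul_comm (Nat.card (powMonoidHom (q ^ j) : G' →* G').ker)] at hqj
      exact (Nat.pow_le_pow_iff_right hq.one_lt).1
        (Nat.le_of_mul_le_mul_left hqj (Nat.mul_pos Nat.card_pos Nat.card_pos))
    · rw [Finset.filter_false_of_mem]
      · simp
      · rintro i - ⟨rfl, -⟩
        exact hq (hp i)
  have hinj (i : {i // 0 < e i}) :
      ∃ g : Multiplicative (ZMod (p i ^ e i)) →*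
        Multiplicative (ZMod (p' (σ i) ^ e' (σ i))), Function.Injective g :=
    exists_injective_zmod_hom_of_dvd (pow_ne_zero _ (hp' _).ne_zero) <| by
      rw [(hσr i).1]
      exact pow_dvd_pow _ (hσr i).2
  choose g hg using hinj
  let φ : ((i : ι) → Multiplicative (ZMod (p i ^ e i))) →*
      ((k : κ) → Multiplicative (ZMod (p' k ^ e' k))) :=
    ∏ i, (MonoidHom.mulSingle _ (σ i)).comp ((g i).comp (Pi.evalMonoidHom _ i.1))
  have hφ (x) (i) : φ x (σ i) = g i (x i) := by
    simp only [φ, MonoidHom.finsetProd_apply, Finset.prod_apply]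
    rw [Finset.prod_eq_single i]
    · simp
    · intro b _ hb
      simp [Pi.mulSingle_eq_of_ne (hσ.ne hb).symm]
    · simp
  refine ⟨(f'.symm.toMonoidHom.comp φ).comp f.toMonoidHom,
    (f'.symm.injective.comp ?_).comp f.injective⟩
  refine (injective_iff_map_eq_one φ).2 fun x hx => funext fun i => ?_
  rcases Nat.eq_zero_or_pos (e i) with hi | hi
  · have : Subsingleton (ZMod (p i ^ e i)) := by
      rw [hi, pow_zero]
      infer_instance
    exact Subsingleton.elim (α := ZMod (p i ^ e i)) _ _
  · refine (injective_iff_map_eq_one _).1 (hg ⟨i, hi⟩) _ ?_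
    rw [← hφ, hx, Pi.one_apply]

/-- If the `p ^ (k + 1)`-torsion of `G` embeds into `G'` and is smaller than the
`p ^ (k + 1)`-torsion of `G'`, and the `p ^ k`-torsion subgroups have equal order, then `G'` has
more subgroups of order `p ^ (k + 1)` than `G`. -/
theorem subCount_lt_subCount {G G' : Type*} [CommGroup G] [CommGroup G'] [Finite G'] {p k : ℕ}
    (hp : p.Prime)
    (heq : Nat.card (powMonoidHom (p ^ k) : G →* G).ker =
      Nat.card (powMonoidHom (p ^ k) : G' →* G').ker)
    {A : Subgroup G} (hA : A = (powMonoidHom (p ^ (k + 1)) : G →* G).ker)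
    (hlt : Nat.card A < Nat.card (powMonoidHom (p ^ (k + 1)) : G' →* G').ker)
    (φ : A →* G') (hφ : Function.Injective φ) :
    subCount G (p ^ (k + 1)) < subCount G' (p ^ (k + 1)) := by
  have : Fact p.Prime := ⟨hp⟩
  have hle (H : Subgroup G) (hH : Nat.card H = p ^ (k + 1)) : H ≤ A := fun x hx => by
    have : (⟨x, hx⟩ : H) ^ Nat.card H = 1 := pow_card_eq_one'
    rw [hH] at this
    simpa [hA, MonoidHom.mem_ker] using congrArg Subtype.val this
  have hlow : (powMonoidHom (p ^ k) : G' →* G').ker ≤ φ.range := by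
    have hle' : (powMonoidHom (p ^ k) : G →* G).ker ≤ A := fun x hx => by
      rw [hA, MonoidHom.mem_ker, powMonoidHom_apply, pow_succ, pow_mul]
      rw [MonoidHom.mem_ker, powMonoidHom_apply] at hx
      rw [hx, one_pow]
    have hmap : (((powMonoidHom (p ^ k) : G →* G).ker).subgroupOf A).map φ =
        (powMonoidHom (p ^ k) : G' →* G').ker := by
      refine Subgroup.eq_of_le_of_card_ge ?_ ?_
      · rintro _ ⟨x, hx, rfl⟩
        have hx' : x ^ p ^ k = 1 := Subtype.ext hx
        rw [MonoidHom.mem_ker, powMonoidHom_apply, ← map_pow, hx', map_one]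
      · rw [Subgroup.card_map_of_injective hφ,
          Nat.card_congr (Subgroup.subgroupOfEquivOfLe hle').toEquiv, heq]
    rw [← hmap]
    exact Subgroup.map_le_range _ _
  obtain ⟨x, hx, hxφ⟩ : ∃ x ∈ (powMonoidHom (p ^ (k + 1)) : G' →* G').ker, x ∉ φ.range := by
    by_contra! hcon
    have := Subgroup.card_le_of_le (show (powMonoidHom (p ^ (k + 1)) : G' →* G').ker ≤ φ.range
      from hcon)
    have hr : Nat.card φ.range = Nat.card A := Nat.card_congr (φ.ofInjective hφ).symm.toEquiv
    omega
  have hord : Nat.card (Subgroup.zpowers x) = p ^ (k + 1) := by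
    rw [Nat.card_zpowers]
    exact orderOf_eq_prime_pow (fun h => hxφ (hlow h)) hx
  let F (H : {H : Subgroup G // Nat.card H = p ^ (k + 1)}) :
      {H : Subgroup G' // Nat.card H = p ^ (k + 1)} :=
    ⟨(H.1.subgroupOf A).map φ, by
      rw [Subgroup.card_map_of_injective hφ,
        Nat.card_congr (Subgroup.subgroupOfEquivOfLe (hle H.1 H.2)).toEquiv, H.2]⟩
  have hF : Function.Injective F := fun H K hHK => by
    have := Subgroup.map_injective hφ (congrArg Subtype.val hHK)
    rw [Subgroup.subgroupOf_inj, inf_of_le_left (hle _ H.2), inf_of_le_left (hle _ K.2)] at this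
    exact Subtype.ext this
  refine lt_of_le_of_ne (Nat.card_le_card_of_injective F hF) fun hcard => ?_
  obtain ⟨H, hH⟩ := ((Nat.bijective_iff_injective_and_card F).2 ⟨hF, hcard⟩).2
    ⟨Subgroup.zpowers x, hord⟩
  have : x ∈ (F H).1 := by
    rw [hH]
    exact Subgroup.mem_zpowers x
  exact hxφ (Subgroup.map_le_range _ _ this)

/-- The `m`-torsion of the `n`-torsion of `G` is as large as its `m.gcd n`-torsion. -/
theorem card_powMonoidHom_ker_ker (G : Type*) [CommGroup G] (m n : ℕ) :
    Nat.card (powMonoidHom m : (powMonoidHom n : G →* G).ker →* _).ker =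
      Nat.card (powMonoidHom (m.gcd n) : G →* G).ker := by
  refine Nat.card_congr
    { toFun x := ⟨x.1.1, ?_⟩
      invFun x := ⟨⟨x.1, ?_⟩, ?_⟩
      left_inv _ := rfl
      right_inv _ := rfl }
  · exact pow_gcd_eq_one.2 ⟨congrArg Subtype.val x.2, x.1.2⟩
  · exact (pow_gcd_eq_one.1 x.2).2
  · exact Subtype.ext (pow_gcd_eq_one.1 x.2).1

theorem card_powMonoidHom_ker_one (G : Type*) [CommGroup G] :
    Nat.card (powMonoidHom 1 : G →* G).ker = 1 := by
  rw [Subgroup.card_eq_one, eq_bot_iff]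
  intro x hx
  simpa [MonoidHom.mem_ker] using hx

theorem card_powMonoidHom_ker_le_of_subCount_eq {G G' : Type*} [CommGroup G] [CommGroup G']
    [Finite G] [Finite G'] {p k : ℕ} (hp : p.Prime)
    (hsub : subCount G (p ^ (k + 1)) = subCount G' (p ^ (k + 1)))
    (heq : ∀ j ≤ k, Nat.card (powMonoidHom (p ^ j) : G →* G).ker =
      Nat.card (powMonoidHom (p ^ j) : G' →* G').ker) :
    Nat.card (powMonoidHom (p ^ (k + 1)) : G' →* G').ker ≤
      Nat.card (powMonoidHom (p ^ (k + 1)) : G →* G).ker := by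
  by_contra! hlt
  obtain ⟨φ, hφ⟩ := exists_injective_of_card_powMonoidHom_ker_le
    (G := (powMonoidHom (p ^ (k + 1)) : G →* G).ker)
    (G' := (powMonoidHom (p ^ (k + 1)) : G' →* G').ker) fun q j hq => by
      simp only [card_powMonoidHom_ker_ker]
      by_cases hqp : q = p
      · subst hqp
        rcases lt_trichotomy j k with hj | rfl | hj
        · rw [Nat.gcd_eq_left (pow_dvd_pow q (by omega)),
            Nat.gcd_eq_left (pow_dvd_pow q (by omega)), heq _ (by omega), heq _ hj.le]
        · rw [Nat.gcd_self, Nat.gcd_eq_left (pow_dvd_pow q (by omega)), heq _ le_rfl]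
          exact Nat.mul_le_mul_right _ hlt.le
        · rw [Nat.gcd_eq_right (pow_dvd_pow q (by omega)),
            Nat.gcd_eq_right (pow_dvd_pow q (by omega)), mul_comm]
      · have hc := (Nat.coprime_primes hq hp).2 hqp
        rw [(hc.pow _ _).gcd_eq_one, (hc.pow _ _).gcd_eq_one, card_powMonoidHom_ker_one,
          card_powMonoidHom_ker_one]
  exact (subCount_lt_subCount hp (heq k le_rfl) rfl hlt ((Subgroup.subtype _).comp φ)
    ((Subgroup.subtype_injective _).comp hφ)).ne hsub

theorem card_powMonoidHom_ker_eq_of_subCount_eq {G G' : Type*} [CommGroup G] [CommGroup G']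
    [Finite G] [Finite G'] (h : ∀ m : ℕ, subCount G m = subCount G' m) {p : ℕ} (hp : p.Prime)
    (j : ℕ) :
    Nat.card (powMonoidHom (p ^ j) : G →* G).ker =
      Nat.card (powMonoidHom (p ^ j) : G' →* G').ker := by
  induction j using Nat.strong_induction_on with
  | _ j ih =>
    rcases j with - | k
    · rw [pow_zero, card_powMonoidHom_ker_one, card_powMonoidHom_ker_one]
    · exact le_antisymm
        (card_powMonoidHom_ker_le_of_subCount_eq hp (h _).symm fun j hj =>
          (ih j (Nat.lt_succ_of_le hj)).symm)
        (card_powMonoidHom_ker_le_of_subCount_eq hp (h _) fun j hj =>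
          ih j (Nat.lt_succ_of_le hj))

end CommGroup

/-- Within finite abelian groups, the zeta function determines the isomorphism
class: if `a_m(G) = a_m(G')` for all `m`, then `G ≅ G'`. -/
theorem stmt_17 (G G' : Type*) [CommGroup G] [CommGroup G'] [Finite G] [Finite G']
    (h : ∀ m : ℕ, subCount G m = subCount G' m) :
    Nonempty (G ≃* G') := by
  have heq (q j : ℕ) (hq : q.Prime) := CommGroup.card_powMonoidHom_ker_eq_of_subCount_eq h hq j
  obtain ⟨f, hf⟩ := CommGroup.exists_injective_of_card_powMonoidHom_ker_le (G := G) (G' := G')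
    fun q j hq => by rw [heq q j hq, heq q (j + 1) hq]
  obtain ⟨f', hf'⟩ := CommGroup.exists_injective_of_card_powMonoidHom_ker_le (G := G') (G' := G)
    fun q j hq => by rw [heq q j hq, heq q (j + 1) hq]
  exact ⟨MulEquiv.ofBijective f
    (hf.bijective_of_nat_card_le (Nat.card_le_card_of_injective f' hf'))⟩
end
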